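/- For all natural numbers α ≤ μ one has T^{μ}_{α} = 1 in ℚ(q). -/

import Mathlib

/-- The variable `q` in the field `ℚ(q)` of rational functions. -/
noncomputable def qq : RatFunc ℚ := RatFunc.X

/-- The quantum integer `[m] = ∑_{s=0}^{m-1} q^{m-1-2s} = (q^m - q^{-m})/(q - q^{-1})`. -/
noncomputable def qint (m : ℕ) : RatFunc ℚ :=
  ∑ s ∈ Finset.range m, qq ^ ((m : ℤ) - 1 - 2 * (s : ℤ))

/-- The quantum factorial `[m]! = [m][m-1]⋯[1]`. -/
noncomputable def qfact (m : ℕ) : RatFunc ℚ :=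
  ∏ r ∈ Finset.range m, qint (r + 1)

/-- The quantum binomial coefficient `[m]!/([a]![m-a]!)`. -/
noncomputable def qbinom (m a : ℕ) : RatFunc ℚ :=
  qfact m / (qfact a * qfact (m - a))

/-- The sum `T^μ_α` appearing in the computation of the `R`-matrix action on
highest weight vectors. -/
noncomputable def Tsum (μ α : ℕ) : RatFunc ℚ :=
  qq ^ (α * (μ - α + 1)) *
    ∑ n ∈ Finset.range (α + 1),
      (-1) ^ n * qbinom α n * (∏ s ∈ Finset.range n, qint (μ - α + (s + 1))) *
        qq ^ ((α - n) * (μ - α + n + 1) + n * (n - 1) / 2) * (qq - qq⁻¹) ^ n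

lemma qq_ne_zero : qq ≠ 0 := RatFunc.X_ne_zero

lemma qint_mul_sub_inv (m : ℕ) : qint m * (qq - qq⁻¹) = qq ^ m - (qq ^ m)⁻¹ := by
  have hq := qq_ne_zero
  have key : ∀ s ∈ Finset.range m, qq ^ ((m : ℤ) - 1 - 2 * (s : ℤ)) * (qq - qq⁻¹) =
      qq ^ ((m : ℤ) - 2 * (s : ℤ)) - qq ^ ((m : ℤ) - 2 * ((s + 1 : ℕ) : ℤ)) := by
    intro s _
    have h₁ : (m : ℤ) - 2 * (s : ℤ) = ((m : ℤ) - 1 - 2 * s) + 1 := by ring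
    have h₂ : (m : ℤ) - 2 * ((s + 1 : ℕ) : ℤ) = ((m : ℤ) - 1 - 2 * s) - 1 := by push_cast; ring
    rw [h₁, h₂, zpow_add_one₀ hq, zpow_sub_one₀ hq]
    ring
  rw [qint, Finset.sum_mul, Finset.sum_congr rfl key,
    Finset.sum_range_sub' (fun s : ℕ => qq ^ ((m : ℤ) - 2 * (s : ℤ)))]
  have h₃ : (m : ℤ) - 2 * (m : ℤ) = -m := by ring
  simp [h₃]

lemma qq_pow_ne_one {m : ℕ} (hm : m ≠ 0) : qq ^ m ≠ 1 := by
  intro h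
  have h' : algebraMap (Polynomial ℚ) (RatFunc ℚ) (Polynomial.X ^ m) =
      algebraMap (Polynomial ℚ) (RatFunc ℚ) 1 := by
    simpa [qq] using h
  have h'' := congrArg Polynomial.natDegree (RatFunc.algebraMap_injective ℚ h')
  simp at h''
  exact hm h''

lemma qq_sub_inv_ne_zero : qq - qq⁻¹ ≠ 0 := by
  intro h
  apply qq_pow_ne_one two_ne_zero
  have hq := qq_ne_zero
  field_simp at h
  linear_combination h

lemma qint_succ_ne_zero (m : ℕ) : qint (m + 1) ≠ 0 := by
  intro h
  have h₁ := qint_mul_sub_inv (m + 1)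
  rw [h, zero_mul] at h₁
  have hq : qq ^ (m + 1) ≠ 0 := pow_ne_zero _ qq_ne_zero
  apply qq_pow_ne_one (m := (m + 1) * 2) (by omega)
  rw [pow_mul]
  field_simp at h₁
  linear_combination -h₁

lemma qfact_succ (m : ℕ) : qfact (m + 1) = qfact m * qint (m + 1) :=
  Finset.prod_range_succ _ _

lemma qfact_ne_zero (m : ℕ) : qfact m ≠ 0 :=
  Finset.prod_ne_zero_iff.mpr fun r _ => qint_succ_ne_zero r

lemma qint_add (a b : ℕ) : qint (a + b) = (qq ^ a)⁻¹ * qint b + qq ^ b * qint a := by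
  apply mul_right_cancel₀ qq_sub_inv_ne_zero
  have ha : qq ^ a ≠ 0 := pow_ne_zero _ qq_ne_zero
  have hb : qq ^ b ≠ 0 := pow_ne_zero _ qq_ne_zero
  rw [add_mul, mul_assoc, mul_assoc, qint_mul_sub_inv, qint_mul_sub_inv, qint_mul_sub_inv, pow_add]
  field_simp
  ring

/-- Gaussian binomial coefficients, defined by the quantum Pascal rule; unlike `qbinom`, they
vanish above the diagonal. -/
noncomputable def gaussBinom : ℕ → ℕ → RatFunc ℚ
  | _, 0 => 1
  | 0, _ + 1 => 0
  | n + 1, k + 1 => (qq ^ (k + 1))⁻¹ * gaussBinom n (k + 1) + qq ^ (n - k) * gaussBinom n k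

lemma gaussBinom_zero_right (n : ℕ) : gaussBinom n 0 = 1 := by
  cases n <;> rfl

lemma gaussBinom_succ_succ (n k : ℕ) : gaussBinom (n + 1) (k + 1) =
    (qq ^ (k + 1))⁻¹ * gaussBinom n (k + 1) + qq ^ (n - k) * gaussBinom n k := rfl

lemma gaussBinom_eq_zero_of_lt {n k : ℕ} (h : n < k) : gaussBinom n k = 0 := by
  induction n generalizing k with
  | zero => obtain ⟨k, rfl⟩ := Nat.exists_eq_succ_of_ne_zero h.ne'; rfl
  | succ n ih =>
    obtain ⟨k, rfl⟩ := Nat.exists_eq_succ_of_ne_zero (Nat.ne_zero_of_lt h)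
    rw [Nat.succ_eq_add_one, gaussBinom_succ_succ, ih (by omega), ih (by omega)]
    simp

lemma gaussBinom_mul_qfact {n a b : ℕ} (h : a + b = n) :
    gaussBinom n a * (qfact a * qfact b) = qfact n := by
  induction n generalizing a b with
  | zero =>
    obtain ⟨rfl, rfl⟩ : a = 0 ∧ b = 0 := by omega
    simp [gaussBinom_zero_right, qfact]
  | succ n ih =>
    rcases a with _ | a
    · obtain rfl : b = n + 1 := by omega
      simp [gaussBinom_zero_right, qfact]
    have h₁ := ih (a := a) (b := b) (by omega)
    have hs : n - a = b := by omega
    rcases b with _ | b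
    · obtain rfl : a = n := by omega
      rw [gaussBinom_succ_succ, gaussBinom_eq_zero_of_lt (Nat.lt_succ_self a), qfact_succ, hs]
      linear_combination qint (a + 1) * h₁
    · have h₂ := ih (a := a + 1) (b := b) (by omega)
      have h₃ := qint_add (a + 1) (b + 1)
      rw [h] at h₃
      rw [gaussBinom_succ_succ, hs, qfact_succ n, h₃]
      rw [qfact_succ b] at h₁ ⊢
      rw [qfact_succ a] at h₂ ⊢
      linear_combination (qq ^ (a + 1))⁻¹ * qint (b + 1) * h₂ + qq ^ (b + 1) * qint (a + 1) * h₁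

lemma qbinom_eq_gaussBinom {n k : ℕ} (h : k ≤ n) : qbinom n k = gaussBinom n k := by
  rw [qbinom, div_eq_iff (mul_ne_zero (qfact_ne_zero _) (qfact_ne_zero _)),
    gaussBinom_mul_qfact (by omega)]

lemma sum_gaussBinom_succ (n : ℕ) (f : ℕ → RatFunc ℚ) :
    ∑ k ∈ Finset.range (n + 2), gaussBinom (n + 1) k * f k =
      ∑ k ∈ Finset.range (n + 1), gaussBinom n k * ((qq ^ k)⁻¹ * f k) +
        ∑ k ∈ Finset.range (n + 1), gaussBinom n k * (qq ^ (n - k) * f (k + 1)) := by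
  have h : ∑ k ∈ Finset.range (n + 1), gaussBinom n k * ((qq ^ k)⁻¹ * f k) =
      ∑ k ∈ Finset.range (n + 2), gaussBinom n k * ((qq ^ k)⁻¹ * f k) := by
    rw [Finset.sum_range_succ _ (n + 1), gaussBinom_eq_zero_of_lt (Nat.lt_succ_self n)]
    simp
  rw [h, Finset.sum_range_succ', Finset.sum_range_succ' _ (n + 1), add_right_comm,
    ← Finset.sum_add_distrib]
  congr 1
  · refine Finset.sum_congr rfl fun k _ => ?_
    rw [gaussBinom_succ_succ]
    ring
  · simp [gaussBinom_zero_right]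

lemma sum_gaussBinom_mul_prod (n m : ℕ) :
    ∑ k ∈ Finset.range (n + 1), gaussBinom n k *
      ((-1) ^ k * (∏ s ∈ Finset.range k, (qq ^ (m + (s + 1)) - (qq ^ (m + (s + 1)))⁻¹)) *
        qq ^ ((n - k) * (m + k + 1) + k.choose 2)) = (qq ^ (n * (m + 1)))⁻¹ := by
  have hq := qq_ne_zero
  induction n generalizing m with
  | zero => simp [gaussBinom_zero_right]
  | succ n ih =>
    rw [sum_gaussBinom_succ]
    have h₁ := congrArg (qq ^ (m + 1) * ·) (ih m)
    have h₂ := congrArg (-(qq ^ (m + 1) - (qq ^ (m + 1))⁻¹) * qq ^ n * ·) (ih (m + 1))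
    simp only [Finset.mul_sum] at h₁ h₂
    have h₃ : (qq ^ ((n + 1) * (m + 1)))⁻¹ = qq ^ (m + 1) * (qq ^ (n * (m + 1)))⁻¹ +
        -(qq ^ (m + 1) - (qq ^ (m + 1))⁻¹) * qq ^ n * (qq ^ (n * (m + 1 + 1)))⁻¹ := by
      have e₁ : (n + 1) * (m + 1) = n * (m + 1) + (m + 1) := by ring
      have e₂ : n * (m + 1 + 1) = n * (m + 1) + n := by ring
      rw [e₁, e₂, pow_add _ (n * (m + 1)) (m + 1), pow_add _ (n * (m + 1)) n]
      generalize qq ^ (n * (m + 1)) = x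
      have hn : qq ^ n ≠ 0 := pow_ne_zero _ hq
      rw [mul_inv, mul_inv]
      field_simp
      ring
    rw [h₃, ← h₁, ← h₂]
    congr 1
    · refine Finset.sum_congr rfl fun k hk => ?_
      obtain ⟨d, rfl⟩ := Nat.exists_eq_add_of_le (Nat.lt_succ_iff.mp (Finset.mem_range.mp hk))
      have e₁ : k + d + 1 - k = d + 1 := by omega
      have e₂ : (d + 1) * (m + k + 1) + k.choose 2 =
          k + ((m + 1) + (d * (m + k + 1) + k.choose 2)) := by ring
      rw [e₁, Nat.add_sub_cancel_left, e₂, pow_add _ k, pow_add _ (m + 1)]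
      have hk : qq ^ k ≠ 0 := pow_ne_zero _ hq
      field_simp
    · refine Finset.sum_congr rfl fun k hk => ?_
      obtain ⟨d, rfl⟩ := Nat.exists_eq_add_of_le (Nat.lt_succ_iff.mp (Finset.mem_range.mp hk))
      have e₁ : k + d + 1 - (k + 1) = d := by omega
      have e₂ : (k + 1).choose 2 = k + k.choose 2 := by
        rw [Nat.choose_succ_succ' k 1, Nat.choose_one_right]
      have e₃ : ∀ s : ℕ, m + (s + 1 + 1) = m + 1 + (s + 1) := fun s => by ring
      have e₄ : m + (k + 1) + 1 = m + 1 + k + 1 := by ring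
      rw [e₁, Nat.add_sub_cancel_left, Finset.prod_range_succ', e₂, e₄]
      simp only [e₃, zero_add]
      generalize ∏ s ∈ Finset.range k,
        (qq ^ (m + 1 + (s + 1)) - (qq ^ (m + 1 + (s + 1)))⁻¹) = P
      ring

/-- For all `α ≤ μ` one has `T^μ_α = 1`. -/
theorem Tsum_eq_one (μ α : ℕ) (h : α ≤ μ) : Tsum μ α = 1 := by
  rw [Tsum]
  generalize μ - α = m
  refine Eq.trans ?_ (mul_inv_cancel₀ (pow_ne_zero (α * (m + 1)) qq_ne_zero))
  rw [← sum_gaussBinom_mul_prod α m]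
  congr 1
  refine Finset.sum_congr rfl fun k hk => ?_
  rw [qbinom_eq_gaussBinom (Nat.lt_succ_iff.mp (Finset.mem_range.mp hk)), Nat.choose_two_right]
  have hprod : ∏ s ∈ Finset.range k, (qq ^ (m + (s + 1)) - (qq ^ (m + (s + 1)))⁻¹) =
      (∏ s ∈ Finset.range k, qint (m + (s + 1))) * (qq - qq⁻¹) ^ k := by
    simp only [← qint_mul_sub_inv, Finset.prod_mul_distrib, Finset.prod_const, Finset.card_range]
  rw [hprod]
  ring
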